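/- arXiv:2604.08205 — 3 statements merged into one kernel-verified Lean document; each statement's English description precedes it below -/
import Mathlib

section
/- Let B ≥ 4.2 be a real number and set b = B / ln B. For every finite list σ = (σ_1, …, σ_n) of real numbers with 1 ≤ |σ_i| ≤ b for all i, and every starting state s_0 ∈ [−B, B], all intermediate states of the Exp algorithm run on σ starting from state s_0 lie in the interval [−B, B]. -/
open Classical in
/-- One step of the `Exp` algorithm with threshold parameter `b`:
an incoming item `x` at state `s` is accepted iff `s * x < 0` or
`|x| ≤ b * exp (-|s| / b)`; acceptance moves the state to `s + x`. -/
noncomputable def expState (b : ℝ) (s x : ℝ) : ℝ :=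
  if s * x < 0 ∨ |x| ≤ b * Real.exp (-|s| / b) then s + x else s

theorem log_le_mul_log_log {B : ℝ} (hB : 4.2 ≤ B) :
    1.4 ≤ Real.log B ∧ Real.log B ≤ B * Real.log (Real.log B) := by
  have hB0 : 0 < B := by linarith
  have hL : 1.4 ≤ Real.log B := by
    rw [Real.le_log_iff_exp_le hB0]
    refine le_trans ?_ hB
    have h5 : Real.exp 1.4 ^ 5 = Real.exp 1 ^ 7 := by
      rw [← Real.exp_nat_mul, ← Real.exp_nat_mul]
      norm_num
    have h7 : Real.exp 1 ^ 7 ≤ 2.7182818286 ^ 7 :=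
      pow_le_pow_left₀ (Real.exp_pos 1).le Real.exp_one_lt_d9.le 7
    refine le_of_pow_le_pow_left₀ (n := 5) (by norm_num) (by norm_num) ?_
    rw [h5]
    exact h7.trans (by norm_num)
  refine ⟨hL, ?_⟩
  have hlog := Real.le_log_one_add_of_nonneg (x := Real.log B - 1) (by linarith)
  have hquad := Real.quadratic_le_exp_of_nonneg (x := Real.log B) (by linarith)
  rw [Real.exp_log hB0] at hquad
  rw [show 1 + (Real.log B - 1) = Real.log B by ring] at hlog
  generalize Real.log B = l at *
  refine le_trans ?_ (mul_le_mul_of_nonneg_left hlog hB0.le)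
  rw [← mul_div_assoc, le_div_iff₀ (by linarith)]
  rcases le_total l 6 with h | h
  · nlinarith [mul_nonneg (sub_nonneg.2 hL) (sub_nonneg.2 h),
      mul_nonneg (sub_nonneg.2 hB) (by linarith : (0 : ℝ) ≤ l - 1)]
  · nlinarith [mul_nonneg hB0.le (sub_nonneg.2 h)]

/-- An item of size `y ≥ 1` within the acceptance threshold at distance `s` from the origin
satisfies `s + y ≤ b * log b + 1`. -/
theorem add_le_of_le_mul_exp {b s y : ℝ} (hy : 1 ≤ y) (hyb : y ≤ b)
    (h : y ≤ b * Real.exp (-s / b)) : s + y ≤ b * Real.log b + 1 := by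
  have hy0 : 0 < y := by linarith
  have hb0 : 0 < b := by linarith
  have h₁ : Real.log y ≤ Real.log b + -s / b := by
    have := Real.log_le_log hy0 h
    rwa [Real.log_mul hb0.ne' (Real.exp_pos _).ne', Real.log_exp] at this
  have h₂ : b * Real.log y ≤ b * Real.log b - s := by
    have := mul_le_mul_of_nonneg_left h₁ hb0.le
    rwa [mul_add, mul_div_cancel₀ _ hb0.ne', ← sub_eq_add_neg] at this
  have h₃ : y - 1 ≤ b * Real.log y := by
    have hlog := Real.one_sub_inv_le_log_of_pos hy0
    have hinv : y⁻¹ ≤ 1 := inv_le_one_of_one_le₀ hy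
    calc y - 1 = y * (1 - y⁻¹) := by field_simp
      _ ≤ b * (1 - y⁻¹) := mul_le_mul_of_nonneg_right hyb (by linarith)
      _ ≤ b * Real.log y := mul_le_mul_of_nonneg_left hlog hb0.le
  linarith

theorem expState_mem_Icc {B b s x : ℝ} (hB : 4.2 ≤ B) (hb : b = B / Real.log B)
    (hx : 1 ≤ |x| ∧ |x| ≤ b) (hs : s ∈ Set.Icc (-B) B) :
    expState b s x ∈ Set.Icc (-B) B := by
  obtain ⟨hL, hLL⟩ := log_le_mul_log_log hB
  have hL0 : 0 < Real.log B := by linarith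
  have hbL : b * Real.log B = B := by rw [hb]; field_simp
  have hb0 : 0 < b := by linarith
  have hbB : b ≤ B := by nlinarith
  have hx' := abs_le.1 hx.2
  unfold expState
  split_ifs with h
  · rcases h with h | h
    · rcases mul_neg_iff.1 h with ⟨h₁, h₂⟩ | ⟨h₁, h₂⟩ <;>
        constructor <;> linarith [hs.1, hs.2]
    · have hlogb : Real.log b = Real.log B - Real.log (Real.log B) := by
        rw [hb, Real.log_div (by linarith) hL0.ne']
      have hone : 1 ≤ b * Real.log (Real.log B) := by
        rw [hb, div_mul_eq_mul_div, le_div_iff₀ hL0]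
        linarith
      have hadd := add_le_of_le_mul_exp hx.1 hx.2 h
      rw [hlogb, mul_sub, hbL] at hadd
      exact abs_le.1 ((abs_add_le s x).trans (by linarith))
  · exact hs

theorem stmt_2 (B : ℝ) (hB : 4.2 ≤ B) (b : ℝ) (hb : b = B / Real.log B)
    (σ : List ℝ) (hσ : ∀ x ∈ σ, 1 ≤ |x| ∧ |x| ≤ b)
    (s₀ : ℝ) (hs₀ : s₀ ∈ Set.Icc (-B) B) :
    ∀ n : ℕ, (σ.take n).foldl (expState b) s₀ ∈ Set.Icc (-B) B := by
  intro n
  have key : ∀ (τ : List ℝ) (s : ℝ), (∀ x ∈ τ, 1 ≤ |x| ∧ |x| ≤ b) → s ∈ Set.Icc (-B) B →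
      τ.foldl (expState b) s ∈ Set.Icc (-B) B := by
    intro τ
    induction τ with
    | nil => exact fun s _ hs => hs
    | cons x τ ih =>
      exact fun s hτ hs => ih _ (fun y hy => hτ y (List.mem_cons_of_mem x hy))
        (expState_mem_Icc hB hb (hτ x List.mem_cons_self) hs)
  exact key _ _ (fun x hx => hσ x (List.mem_of_mem_take hx)) hs₀
end

section
/- Define the sequence (U_n) of reals by U_0 = 1 and U_{n+1} = U_n · exp(1/U_n) for all n ∈ ℕ. Then for all n ∈ ℕ: U_{n+1} ≤ U_n + 1 + 1/(2(n+1)) + 1/(3(n+1)^2). -/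
noncomputable def U : ℕ → ℝ
  | 0 => 1
  | n + 1 => U n * Real.exp (1 / U n)

theorem natCast_add_one_le_U (n : ℕ) : (n : ℝ) + 1 ≤ U n := by
  induction n with
  | zero => simp [U]
  | succ n ih =>
    have hpos : 0 < U n := lt_of_lt_of_le (by positivity) ih
    have h := mul_le_mul_of_nonneg_left (Real.add_one_le_exp (1 / U n)) hpos.le
    rw [mul_add, mul_one_div_cancel hpos.ne'] at h
    rw [U]
    push_cast
    linarith

theorem mul_exp_one_div_le {u : ℝ} (hu : 1 ≤ u) :
    u * Real.exp (1 / u) ≤ u + 1 + 1 / (2 * u) + 1 / (3 * u ^ 2) := by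
  have hpos : 0 < u := by linarith
  have hx : 0 ≤ 1 / u := by positivity
  have h := Real.exp_bound' hx ((div_le_one hpos).2 hu) (n := 3) (by norm_num)
  norm_num [Finset.sum_range_succ, Nat.factorial] at h
  have hexp : Real.exp (1 / u) ≤ 1 + 1 / u + (1 / u) ^ 2 / 2 + (1 / u) ^ 3 / 3 := by
    have h3 : 0 ≤ (u ^ 3)⁻¹ := by positivity
    simp only [one_div, inv_pow]
    linarith
  calc u * Real.exp (1 / u)
      ≤ u * (1 + 1 / u + (1 / u) ^ 2 / 2 + (1 / u) ^ 3 / 3) :=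
        mul_le_mul_of_nonneg_left hexp hpos.le
    _ = u + 1 + 1 / (2 * u) + 1 / (3 * u ^ 2) := by field_simp

theorem stmt_6 :
    ∀ n : ℕ, U (n + 1) ≤ U n + 1 + 1 / (2 * ((n : ℝ) + 1)) + 1 / (3 * ((n : ℝ) + 1) ^ 2) := by
  intro n
  have hn : (n : ℝ) + 1 ≤ U n := natCast_add_one_le_U n
  have hU : 1 ≤ U n := le_trans (by simp) hn
  rw [U]
  refine (mul_exp_one_div_le hU).trans ?_
  gcongr
end

section
/- Define the sequence (U_n) of reals by U_0 = 1 and U_{n+1} = U_n · exp(1/U_n) for all n ∈ ℕ. Let b > 0 be a real number, let p ∈ ℕ, and let s : ℕ → ℝ be a sequence with s_0 = 0 such that for all i < p: s_i ≤ s_{i+1} ≤ s_i + b·exp(−s_i/b). Then for all i ≤ p, s_i ≤ b · ln(U_i). -/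
theorem one_le_U (n : ℕ) : 1 ≤ U n := by
  induction n with
  | zero => simp [U]
  | succ n ih =>
    have h : 1 ≤ Real.exp (1 / U n) := Real.one_le_exp (by positivity)
    exact one_le_mul_of_one_le_of_one_le ih h

theorem log_U_succ (n : ℕ) :
    Real.log (U (n + 1)) = Real.log (U n) + Real.exp (-Real.log (U n)) := by
  have h : 0 < U n := one_pos.trans_le (one_le_U n)
  rw [U, Real.log_mul h.ne' (Real.exp_pos _).ne', Real.log_exp, Real.exp_neg, Real.exp_log h,
    one_div]

theorem add_exp_neg_le_add_exp_neg {x y : ℝ} (hx : 0 ≤ x) (hxy : x ≤ y) :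
    x + Real.exp (-x) ≤ y + Real.exp (-y) := by
  have h_split : Real.exp (-y) = Real.exp (-x) * Real.exp (x - y) := by
    rw [← Real.exp_add]
    ring_nf
  have h_tangent : x - y + 1 ≤ Real.exp (x - y) := Real.add_one_le_exp _
  have h_le_one : Real.exp (-x) ≤ 1 := Real.exp_le_one_iff.mpr (by linarith)
  rw [h_split]
  nlinarith [mul_le_mul_of_nonneg_left h_tangent (Real.exp_pos (-x)).le,
    mul_nonneg (sub_nonneg.mpr h_le_one) (sub_nonneg.mpr hxy)]

theorem stmt_15 (b : ℝ) (hb : 0 < b) (p : ℕ) (s : ℕ → ℝ) (hs0 : s 0 = 0)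
    (hstep : ∀ i < p, s i ≤ s (i + 1) ∧ s (i + 1) ≤ s i + b * Real.exp (-(s i) / b)) :
    ∀ i ≤ p, s i ≤ b * Real.log (U i) := by
  suffices h : ∀ i ≤ p, 0 ≤ s i ∧ s i ≤ b * Real.log (U i) from fun i hi => (h i hi).2
  intro i
  induction i with
  | zero => simp [hs0, U]
  | succ n ih =>
    intro hn
    obtain ⟨h_nonneg, h_le⟩ := ih (by lia)
    obtain ⟨h_mono, h_step⟩ := hstep n (by lia)
    refine ⟨h_nonneg.trans h_mono, h_step.trans ?_⟩
    have h_div : s n / b ≤ Real.log (U n) := (div_le_iff₀' hb).mpr h_le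
    calc s n + b * Real.exp (-(s n) / b) = b * (s n / b + Real.exp (-(s n / b))) := by
          rw [neg_div]
          field_simp
      _ ≤ b * (Real.log (U n) + Real.exp (-Real.log (U n))) :=
          mul_le_mul_of_nonneg_left
            (add_exp_neg_le_add_exp_neg (div_nonneg h_nonneg hb.le) h_div) hb.le
      _ = b * Real.log (U (n + 1)) := by rw [log_U_succ]
end
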